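/- arXiv:2102.08607 — 2 statements merged into one kernel-verified Lean document; each statement's English description precedes it below -/
import Mathlib

section
/- Suppose that for every (s,a) ∈ 𝒮 × 𝒜 the map θ ↦ ψ(s,a;θ) is twice continuously differentiable on ℝ^d with ‖∇_θ ψ(s,a;θ)‖ ≤ ℓ_ψ and ‖∇²_θ ψ(s,a;θ)‖ ≤ L_ψ (operator norm of the second derivative) for all θ, where ℓ_ψ, L_ψ ≥ 0. Then for every state-action pair (s,a) and every θ ∈ ℝ^d, the second derivative of the log-policy satisfies ‖∇²_θ log π_θ(a|s)‖ ≤ 2(L_ψ + ℓ_ψ²). -/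
open Finset

/-- The soft-max policy `π_θ(a|s) = exp (ψ s a θ) / ∑ a', exp (ψ s a' θ)`. -/
noncomputable def softmaxPolicy {S A : Type*} [Fintype A] {d : ℕ}
    (ψ : S → A → EuclideanSpace ℝ (Fin d) → ℝ)
    (θ : EuclideanSpace ℝ (Fin d)) (s : S) (a : A) : ℝ :=
  Real.exp (ψ s a θ) / ∑ a', Real.exp (ψ s a' θ)

theorem norm_sum_smul_le_of_sum_eq_one {A F : Type*} [Fintype A] [NormedAddCommGroup F]
    [NormedSpace ℝ F] {p : A → ℝ} (hp : ∀ a, 0 ≤ p a) (hp₁ : ∑ a, p a = 1) {v : A → F} {C : ℝ}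
    (hv : ∀ a, ‖v a‖ ≤ C) : ‖∑ a, p a • v a‖ ≤ C := by
  calc ‖∑ a, p a • v a‖ ≤ ∑ a, p a * C := by
        refine norm_sum_le_of_le _ fun a _ => ?_
        rw [norm_smul, Real.norm_of_nonneg (hp a)]
        exact mul_le_mul_of_nonneg_left (hv a) (hp a)
    _ = C := by rw [← sum_mul, hp₁, one_mul]

theorem norm_sub_sum_smul_add_le {A F : Type*} [Fintype A] [NormedAddCommGroup F]
    [NormedSpace ℝ F] {p : A → ℝ} (hp : ∀ a, 0 ≤ p a) (hp₁ : ∑ a, p a = 1) {u v : A → F}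
    {C K : ℝ} (hu : ∀ a, ‖u a‖ ≤ C) (hv : ∀ a, ‖v a‖ ≤ K) (a : A) :
    ‖u a - ∑ b, p b • (u b + v b)‖ ≤ C + (C + K) :=
  norm_sub_le_of_le (hu a) (norm_sum_smul_le_of_sum_eq_one hp hp₁ fun b =>
    norm_add_le_of_le (hu b) (hv b))

theorem norm_sub_sum_smul_add_smulRight_le {A E : Type*} [Fintype A] [NormedAddCommGroup E]
    [NormedSpace ℝ E] {p : A → ℝ} (hp : ∀ a, 0 ≤ p a) (hp₁ : ∑ a, p a = 1)
    {D : A → E →L[ℝ] ℝ} {H : A → E →L[ℝ] E →L[ℝ] ℝ} {l L : ℝ} (hl : 0 ≤ l)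
    (hD : ∀ a, ‖D a‖ ≤ l) (hH : ∀ a, ‖H a‖ ≤ L) (a : A) :
    ‖H a - ∑ b, p b • (H b + (D b - ∑ c, p c • D c).smulRight (D b))‖ ≤ 2 * (L + l ^ 2) := by
  have hm : ‖∑ c, p c • D c‖ ≤ l := norm_sum_smul_le_of_sum_eq_one hp hp₁ hD
  have hT : ∀ b, ‖(D b - ∑ c, p c • D c).smulRight (D b)‖ ≤ (l + l) * l := by
    intro b
    rw [ContinuousLinearMap.norm_smulRight_apply]
    exact mul_le_mul (norm_sub_le_of_le (hD b) hm) (hD b) (norm_nonneg _) (add_nonneg hl hl)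
  have key := norm_sub_sum_smul_add_le (F := E →L[ℝ] E →L[ℝ] ℝ) hp hp₁ hH hT a
  linarith

section

variable {S A : Type*} [Fintype A] {d : ℕ} {ψ : S → A → EuclideanSpace ℝ (Fin d) → ℝ}

theorem softmaxPolicy_pos [Nonempty A] (θ : EuclideanSpace ℝ (Fin d)) (s : S) (a : A) :
    0 < softmaxPolicy ψ θ s a :=
  div_pos (Real.exp_pos _) (sum_pos (fun _ _ => Real.exp_pos _) univ_nonempty)

theorem sum_softmaxPolicy [Nonempty A] (θ : EuclideanSpace ℝ (Fin d)) (s : S) :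
    ∑ a, softmaxPolicy ψ θ s a = 1 := by
  have hZ : 0 < ∑ a, Real.exp (ψ s a θ) := sum_pos (fun _ _ => Real.exp_pos _) univ_nonempty
  simp only [softmaxPolicy, ← sum_div]
  exact div_self hZ.ne'

/-- The score function of the soft-max policy is the centred derivative of `ψ`. -/
theorem hasFDerivAt_log_softmaxPolicy [Nonempty A] {s : S}
    {θ : EuclideanSpace ℝ (Fin d)} (hψ : ∀ a, DifferentiableAt ℝ (ψ s a) θ) (a : A) :
    HasFDerivAt (fun θ' => Real.log (softmaxPolicy ψ θ' s a))
      (fderiv ℝ (ψ s a) θ - ∑ b, softmaxPolicy ψ θ s b • fderiv ℝ (ψ s b) θ) θ := by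
  have hZ : ∀ θ', ∑ b, Real.exp (ψ s b θ') ≠ 0 := fun θ' =>
    (sum_pos (fun _ _ => Real.exp_pos _) univ_nonempty).ne'
  have hlog : (fun θ' => Real.log (softmaxPolicy ψ θ' s a)) =
      fun θ' => ψ s a θ' - Real.log (∑ b, Real.exp (ψ s b θ')) := by
    ext θ'
    rw [softmaxPolicy, Real.log_div (Real.exp_ne_zero _) (hZ θ'), Real.log_exp]
  have hsum : HasFDerivAt (fun θ' => ∑ b, Real.exp (ψ s b θ'))
      (∑ b, Real.exp (ψ s b θ) • fderiv ℝ (ψ s b) θ) θ :=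
    HasFDerivAt.fun_sum fun b _ => (hψ b).hasFDerivAt.exp
  rw [hlog]
  refine ((hψ a).hasFDerivAt.fun_sub (hsum.log (hZ θ))).congr_fderiv ?_
  simp only [softmaxPolicy, smul_sum, smul_smul, div_eq_inv_mul]

theorem hasFDerivAt_softmaxPolicy [Nonempty A] {s : S}
    {θ : EuclideanSpace ℝ (Fin d)} (hψ : ∀ a, DifferentiableAt ℝ (ψ s a) θ) (a : A) :
    HasFDerivAt (fun θ' => softmaxPolicy ψ θ' s a)
      (softmaxPolicy ψ θ s a •
        (fderiv ℝ (ψ s a) θ - ∑ b, softmaxPolicy ψ θ s b • fderiv ℝ (ψ s b) θ)) θ := by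
  simpa only [Real.exp_log (softmaxPolicy_pos _ s a)] using
    (hasFDerivAt_log_softmaxPolicy hψ a).exp

theorem hasFDerivAt_sum_softmaxPolicy_smul [Nonempty A] {s : S}
    {θ : EuclideanSpace ℝ (Fin d)} (hψ : ∀ a, DifferentiableAt ℝ (ψ s a) θ)
    (hψ₂ : ∀ a, DifferentiableAt ℝ (fderiv ℝ (ψ s a)) θ) :
    HasFDerivAt (fun θ' => ∑ b, softmaxPolicy ψ θ' s b • fderiv ℝ (ψ s b) θ')
      (∑ b, softmaxPolicy ψ θ s b • (fderiv ℝ (fderiv ℝ (ψ s b)) θ +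
        (fderiv ℝ (ψ s b) θ - ∑ c, softmaxPolicy ψ θ s c • fderiv ℝ (ψ s c) θ).smulRight
          (fderiv ℝ (ψ s b) θ))) θ := by
  refine HasFDerivAt.fun_sum fun b _ => ?_
  refine ((hasFDerivAt_softmaxPolicy hψ b).fun_smul (hψ₂ b).hasFDerivAt).congr_fderiv ?_
  ext u v
  simp
  ring

end

theorem norm_iteratedFDeriv_two {E F : Type*} [NormedAddCommGroup E] [NormedSpace ℝ E]
    [NormedAddCommGroup F] [NormedSpace ℝ F] (f : E → F) (x : E) :
    ‖iteratedFDeriv ℝ 2 f x‖ = ‖fderiv ℝ (fderiv ℝ f) x‖ := by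
  rw [← norm_iteratedFDeriv_one, norm_iteratedFDeriv_fderiv]

/-- If each `θ ↦ ψ(s,a;θ)` is twice continuously differentiable with
`‖∇_θ ψ(s,a;θ)‖ ≤ ℓψ` and `‖∇²_θ ψ(s,a;θ)‖ ≤ Lψ`, then the second derivative of the
log soft-max policy satisfies `‖∇²_θ log π_θ(a|s)‖ ≤ 2 (Lψ + ℓψ²)`. -/
theorem norm_hessian_log_softmaxPolicy_le {S A : Type*} [Fintype S] [Fintype A]
    [Nonempty S] [Nonempty A] {d : ℕ}
    (ψ : S → A → EuclideanSpace ℝ (Fin d) → ℝ)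
    (ℓψ Lψ : ℝ) (hℓ : 0 ≤ ℓψ) (hL : 0 ≤ Lψ)
    (hsmooth : ∀ s a, ContDiff ℝ 2 (ψ s a))
    (hgrad : ∀ s a θ, ‖gradient (ψ s a) θ‖ ≤ ℓψ)
    (hhess : ∀ s a θ, ‖iteratedFDeriv ℝ 2 (ψ s a) θ‖ ≤ Lψ)
    (s : S) (a : A) (θ : EuclideanSpace ℝ (Fin d)) :
    ‖iteratedFDeriv ℝ 2 (fun θ' => Real.log (softmaxPolicy ψ θ' s a)) θ‖ ≤
      2 * (Lψ + ℓψ ^ 2) := by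
  have hdiff : ∀ θ b, DifferentiableAt ℝ (ψ s b) θ := fun θ b =>
    (hsmooth s b).differentiable (by norm_num) θ
  have hdiff₂ : ∀ b, DifferentiableAt ℝ (fderiv ℝ (ψ s b)) θ := fun b =>
    ((hsmooth s b).fderiv_right (m := 1) (by norm_num)).differentiable (by norm_num) θ
  have hD : ∀ b, ‖fderiv ℝ (ψ s b) θ‖ ≤ ℓψ := fun b => by
    simpa [gradient] using hgrad s b θ
  have hD₂ : ∀ b, ‖fderiv ℝ (fderiv ℝ (ψ s b)) θ‖ ≤ Lψ := fun b => by
    rw [← norm_iteratedFDeriv_two]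
    exact hhess s b θ
  have hscore : fderiv ℝ (fun θ' => Real.log (softmaxPolicy ψ θ' s a)) = fun θ' =>
      fderiv ℝ (ψ s a) θ' - ∑ b, softmaxPolicy ψ θ' s b • fderiv ℝ (ψ s b) θ' :=
    funext fun θ' => (hasFDerivAt_log_softmaxPolicy (hdiff θ') a).fderiv
  rw [norm_iteratedFDeriv_two, hscore,
    ((hdiff₂ a).hasFDerivAt.fun_sub (hasFDerivAt_sum_softmaxPolicy_smul (hdiff θ) hdiff₂)).fderiv]
  exact norm_sub_sum_smul_add_smulRight_le (fun b => (softmaxPolicy_pos θ s b).le)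
    (sum_softmaxPolicy θ s) hℓ hD hD₂ a
end

section
/- Suppose that for every (s,a) ∈ 𝒮 × 𝒜 the map θ ↦ ψ(s,a;θ) is differentiable on ℝ^d with ‖∇_θ ψ(s,a;θ)‖ ≤ ℓ_ψ for all θ, where ℓ_ψ ≥ 0, and fix γ ∈ (0,1). Then for any H ≥ 1, any length-H trajectory τ, any θ ∈ ℝ^d and any reward vectors r₁, r₂ : 𝒮×𝒜 → ℝ, the REINFORCE estimators satisfy ‖ĝ(τ|θ,r₁) − ĝ(τ|θ,r₂)‖ ≤ (2ℓ_ψ/(1−γ)²) · max_{(s,a)} |r₁(s,a) − r₂(s,a)|. -/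
open Finset

/-- The on-policy REINFORCE estimator with quasi-reward `r`:
`ĝ(τ|θ,r) = Σ_{t=0}^{H−1} γ^t r(s_t,a_t) Σ_{t'=0}^{t} ∇_θ log π_θ(a_{t'}|s_{t'})`. -/
noncomputable def reinforceEst {S A : Type*} [Fintype A] {d : ℕ}
    (ψ : S → A → EuclideanSpace ℝ (Fin d) → ℝ) (γ : ℝ) {H : ℕ}
    (τ : Fin H → S × A) (θ : EuclideanSpace ℝ (Fin d)) (r : S × A → ℝ) :
    EuclideanSpace ℝ (Fin d) :=
  ∑ t : Fin H, (γ ^ (t : ℕ) * r (τ t)) •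
    ∑ t' ∈ Finset.Iic t,
      gradient (fun θ' => Real.log (softmaxPolicy ψ θ' (τ t').1 (τ t').2)) θ

theorem norm_gradient_eq_norm_fderiv {E : Type*} [NormedAddCommGroup E] [InnerProductSpace ℝ E]
    [CompleteSpace E] (f : E → ℝ) (x : E) : ‖gradient f x‖ = ‖fderiv ℝ f x‖ := by
  simp [gradient]

theorem sum_range_succ_mul_geometric_mul_sq (x : ℝ) (n : ℕ) :
    (∑ t ∈ range n, x ^ t * ((t : ℝ) + 1)) * (1 - x) ^ 2 = 1 - x ^ n * (1 + n * (1 - x)) := by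
  induction n with
  | zero => simp
  | succ k ih =>
    rw [sum_range_succ, add_mul, ih]
    push_cast
    ring

theorem sum_range_succ_mul_geometric_le {x : ℝ} (h0 : 0 ≤ x) (h1 : x < 1) (n : ℕ) :
    ∑ t ∈ range n, x ^ t * ((t : ℝ) + 1) ≤ 1 / (1 - x) ^ 2 := by
  have hx : 0 < 1 - x := sub_pos.2 h1
  rw [le_div_iff₀ (by positivity), sum_range_succ_mul_geometric_mul_sq]
  exact sub_le_self _ (by positivity)

theorem norm_fderiv_log_sum_exp_le {ι E : Type*} [Fintype ι] [Nonempty ι]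
    [NormedAddCommGroup E] [NormedSpace ℝ E] {f : ι → E → ℝ} {x : E} {C : ℝ}
    (hf : ∀ i, DifferentiableAt ℝ (f i) x) (hC : ∀ i, ‖fderiv ℝ (f i) x‖ ≤ C) :
    ‖fderiv ℝ (fun y => Real.log (∑ i, Real.exp (f i y))) x‖ ≤ C := by
  have hpos : 0 < ∑ i, Real.exp (f i x) :=
    sum_pos (fun i _ => Real.exp_pos _) univ_nonempty
  have h := (HasFDerivAt.fun_sum fun i (_ : i ∈ univ) => (hf i).hasFDerivAt.exp).log hpos.ne'
  rw [h.fderiv, norm_smul, Real.norm_of_nonneg (inv_nonneg.2 hpos.le), inv_mul_le_iff₀ hpos,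
    sum_mul]
  refine norm_sum_le_of_le _ fun i _ => ?_
  rw [norm_smul, Real.norm_of_nonneg (Real.exp_pos _).le]
  exact mul_le_mul_of_nonneg_left (hC i) (Real.exp_pos _).le

theorem norm_gradient_log_softmaxPolicy_le {S A : Type*} [Fintype A] {d : ℕ}
    {ψ : S → A → EuclideanSpace ℝ (Fin d) → ℝ} {C : ℝ} {θ : EuclideanSpace ℝ (Fin d)} {s : S}
    (hψ : ∀ a, DifferentiableAt ℝ (ψ s a) θ) (hC : ∀ a, ‖gradient (ψ s a) θ‖ ≤ C) (a : A) :
    ‖gradient (fun θ' => Real.log (softmaxPolicy ψ θ' s a)) θ‖ ≤ 2 * C := by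
  have : Nonempty A := ⟨a⟩
  simp only [norm_gradient_eq_norm_fderiv] at hC ⊢
  have hpos (y) : 0 < ∑ a', Real.exp (ψ s a' y) :=
    sum_pos (fun i _ => Real.exp_pos _) univ_nonempty
  have heq : (fun θ' => Real.log (softmaxPolicy ψ θ' s a)) =
      fun θ' => ψ s a θ' - Real.log (∑ a', Real.exp (ψ s a' θ')) := by
    funext y
    rw [softmaxPolicy, Real.log_div (Real.exp_pos _).ne' (hpos y).ne', Real.log_exp]
  have hd : DifferentiableAt ℝ (fun θ' => Real.log (∑ a', Real.exp (ψ s a' θ'))) θ :=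
    (DifferentiableAt.fun_sum fun i _ => (hψ i).exp).log (hpos θ).ne'
  rw [heq, fderiv_fun_sub (hψ a) hd, two_mul]
  exact (norm_sub_le _ _).trans (add_le_add (hC a) (norm_fderiv_log_sum_exp_le hψ hC))

/-- Lipschitz continuity of the REINFORCE estimator in the quasi-reward:
`‖ĝ(τ|θ,r₁) − ĝ(τ|θ,r₂)‖ ≤ (2ℓψ/(1−γ)²) · max_{(s,a)} |r₁(s,a) − r₂(s,a)|`. -/
theorem reinforceEst_lipschitz_reward {S A : Type*} [Fintype S] [Fintype A]
    [Nonempty S] [Nonempty A] {d : ℕ}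
    (ψ : S → A → EuclideanSpace ℝ (Fin d) → ℝ)
    (ℓψ : ℝ) (hℓ : 0 ≤ ℓψ)
    (hdiff : ∀ s a, Differentiable ℝ (ψ s a))
    (hbound : ∀ s a θ, ‖gradient (ψ s a) θ‖ ≤ ℓψ)
    (γ : ℝ) (hγ0 : 0 < γ) (hγ1 : γ < 1)
    {H : ℕ} (hH : 1 ≤ H) (τ : Fin H → S × A)
    (θ : EuclideanSpace ℝ (Fin d)) (r₁ r₂ : S × A → ℝ) :
    ‖reinforceEst ψ γ τ θ r₁ - reinforceEst ψ γ τ θ r₂‖ ≤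
      2 * ℓψ / (1 - γ) ^ 2 *
        Finset.univ.sup' Finset.univ_nonempty (fun p : S × A => |r₁ p - r₂ p|) := by
  set D := univ.sup' univ_nonempty (fun p : S × A => |r₁ p - r₂ p|)
  have hle (p : S × A) : |r₁ p - r₂ p| ≤ D :=
    le_sup' (fun p : S × A => |r₁ p - r₂ p|) (mem_univ p)
  have hD0 : 0 ≤ D := (abs_nonneg _).trans (hle (τ ⟨0, hH⟩))
  have hscore (t : Fin H) :
      ‖∑ t' ∈ Iic t, gradient (fun θ' => Real.log (softmaxPolicy ψ θ' (τ t').1 (τ t').2)) θ‖ ≤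
        ((t : ℝ) + 1) * (2 * ℓψ) := by
    refine (norm_sum_le_of_le _ fun t' _ => norm_gradient_log_softmaxPolicy_le
      (fun a => hdiff _ a θ) (fun a => hbound _ a θ) _).trans_eq ?_
    simp
  have hsum : ‖reinforceEst ψ γ τ θ r₁ - reinforceEst ψ γ τ θ r₂‖ ≤
      ∑ t : Fin H, γ ^ (t : ℕ) * ((t : ℝ) + 1) * (2 * ℓψ * D) := by
    rw [reinforceEst, reinforceEst, ← sum_sub_distrib]
    refine norm_sum_le_of_le _ fun t _ => ?_
    rw [← sub_smul, ← mul_sub, norm_smul, norm_mul, Real.norm_of_nonneg (by positivity),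
      Real.norm_eq_abs]
    calc _ ≤ γ ^ (t : ℕ) * D * (((t : ℝ) + 1) * (2 * ℓψ)) := by
          gcongr
          · exact hle _
          · exact hscore t
      _ = _ := by ring
  rw [← sum_mul, Fin.sum_univ_eq_sum_range (fun t => γ ^ t * ((t : ℝ) + 1))] at hsum
  calc _ ≤ _ := hsum
    _ ≤ 1 / (1 - γ) ^ 2 * (2 * ℓψ * D) := by
      gcongr
      exact sum_range_succ_mul_geometric_le hγ0.le hγ1 H
    _ = _ := by ring
end
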